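/- Consider a discrete-time controlled system (S, U, F, ℓ) with ℓ(x,u) > 0 for all x, u, which is exponentially controllable with overshoot C ≥ 1 and decay rate σ ∈ (0,1). Fix a horizon N ≥ 2 and assume that for every state x there is a control sequence u^{*,x} attaining the infimum, J_N(x, u^{*,x}) = V_N(x); define the MPC feedback μ(x) = u^{*,x}_0. Let γ_i = C Σ_{n=0}^{i-1} σ^n and α_N = 1 − ((γ_N − 1)∏_{i=2}^N(γ_i − 1))/(∏_{i=2}^N γ_i − ∏_{i=2}^N(γ_i − 1)), and assume α_N > 0. Then the relaxed dynamic-programming inequality V_N(x) ≥ V_N(F(x, μ(x))) + α_N · ℓ(x, μ(x)) holds for every state x ∈ S. -/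

import Mathlib

open Finset

/-- Trajectory of the discrete-time controlled system `x_{n+1} = F (x_n, u_n)`. -/
def traj {S U : Type*} (F : S → U → S) (x : S) (u : ℕ → U) : ℕ → S
  | 0 => x
  | n + 1 => F (traj F x u n) (u n)

/-- Finite-horizon cost `J_N(x,u) = Σ_{n=0}^{N-1} ℓ(x_n, u_n)`. -/
noncomputable def costJ {S U : Type*} (F : S → U → S) (ℓ : S → U → ℝ)
    (N : ℕ) (x : S) (u : ℕ → U) : ℝ :=
  ∑ n ∈ Finset.range N, ℓ (traj F x u n) (u n)

/-- Finite-horizon value function `V_N(x) = inf_u J_N(x,u)`. -/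
noncomputable def valueV {S U : Type*} (F : S → U → S) (ℓ : S → U → ℝ)
    (N : ℕ) (x : S) : ℝ :=
  ⨅ u : ℕ → U, costJ F ℓ N x u

/-- Pointwise optimal running cost `ℓ*(x) = inf_{u ∈ U} ℓ(x,u)`. -/
noncomputable def ellStar {S U : Type*} (ℓ : S → U → ℝ) (x : S) : ℝ :=
  ⨅ u : U, ℓ x u

theorem traj_shift {S U : Type*} (F : S → U → S) (x : S) (u : ℕ → U) (n : ℕ) :
    traj F (F x (u 0)) (fun k => u (k + 1)) n = traj F x u (n + 1) := by
  induction n with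
  | zero => rfl
  | succ n ih =>
    change F _ _ = F _ _
    rw [ih]

theorem traj_congr {S U : Type*} (F : S → U → S) (x : S) {u v : ℕ → U} {n : ℕ}
    (h : ∀ k < n, u k = v k) : traj F x u n = traj F x v n := by
  induction n with
  | zero => rfl
  | succ n ih =>
    change F _ _ = F _ _
    rw [ih fun k hk => h k (by omega), h n (by omega)]

theorem traj_add {S U : Type*} (F : S → U → S) (x : S) (u : ℕ → U) (j n : ℕ) :
    traj F x u (j + n) = traj F (traj F x u j) (fun k => u (j + k)) n := by
  induction n with
  | zero => rfl
  | succ n ih =>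
    change F _ _ = F _ _
    rw [← ih]
    rfl

theorem costJ_congr {S U : Type*} (F : S → U → S) (ℓ : S → U → ℝ) (x : S) {u v : ℕ → U}
    {n : ℕ} (h : ∀ k < n, u k = v k) : costJ F ℓ n x u = costJ F ℓ n x v := by
  refine Finset.sum_congr rfl fun k hk => ?_
  have hk := Finset.mem_range.1 hk
  rw [traj_congr F x fun i hi => h i (hi.trans hk), h k hk]

theorem costJ_add {S U : Type*} (F : S → U → S) (ℓ : S → U → ℝ) (x : S) (u : ℕ → U)
    (j n : ℕ) : costJ F ℓ (j + n) x u =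
      costJ F ℓ j x u + costJ F ℓ n (traj F x u j) (fun k => u (j + k)) := by
  simp only [costJ, Finset.sum_range_add, traj_add]

theorem costJ_succ {S U : Type*} (F : S → U → S) (ℓ : S → U → ℝ) (x : S) (u : ℕ → U)
    (n : ℕ) : costJ F ℓ (n + 1) x u =
      costJ F ℓ n (F x (u 0)) (fun k => u (k + 1)) + ℓ x (u 0) := by
  simp only [costJ, Finset.sum_range_succ', traj_shift]
  rfl

theorem valueV_le_costJ {S U : Type*} (F : S → U → S) {ℓ : S → U → ℝ}
    (hℓ : ∀ x u, 0 ≤ ℓ x u) (N : ℕ) (x : S) (u : ℕ → U) :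
    valueV F ℓ N x ≤ costJ F ℓ N x u :=
  ciInf_le ⟨0, by rintro _ ⟨v, rfl⟩; exact Finset.sum_nonneg fun _ _ => hℓ _ _⟩ u

/-- Following `u` for `j` steps and `v` afterwards bounds the value function. -/
theorem valueV_add_le {S U : Type*} (F : S → U → S) {ℓ : S → U → ℝ}
    (hℓ : ∀ x u, 0 ≤ ℓ x u) (j n : ℕ) (x : S) (u v : ℕ → U) :
    valueV F ℓ (j + n) x ≤ costJ F ℓ j x u + costJ F ℓ n (traj F x u j) v := by
  set w : ℕ → U := fun k => if k < j then u k else v (k - j)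
  have hw : ∀ k < j, w k = u k := fun k hk => if_pos hk
  have hv : (fun k => w (j + k)) = v := by
    funext k
    simp [w]
  calc valueV F ℓ (j + n) x ≤ costJ F ℓ (j + n) x w := valueV_le_costJ F hℓ _ _ _
    _ = _ := by rw [costJ_add, costJ_congr F ℓ x hw, traj_congr F x hw, hv]

theorem costJ_le_of_exp_decay {S U : Type*} (F : S → U → S) {ℓ : S → U → ℝ}
    (hℓ : ∀ x u, 0 ≤ ℓ x u) {C σ : ℝ} (hC : 0 ≤ C) (hσ : 0 ≤ σ) {x : S} {u : ℕ → U}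
    (hu : ∀ n : ℕ, ℓ (traj F x u n) (u n) ≤ C * σ ^ n * ellStar ℓ x) (N : ℕ) (a : U) :
    costJ F ℓ N x u ≤ (C * ∑ n ∈ Finset.range N, σ ^ n) * ℓ x a := by
  have ha : ellStar ℓ x ≤ ℓ x a := ciInf_le ⟨0, by rintro _ ⟨v, rfl⟩; exact hℓ _ _⟩ a
  rw [Finset.mul_sum, Finset.sum_mul]
  exact Finset.sum_le_sum fun n _ =>
    (hu n).trans (mul_le_mul_of_nonneg_left ha (by positivity))

theorem prod_Icc_mul_le {g b : ℕ → ℝ} {N : ℕ} (hN : 1 ≤ N) (hg : ∀ i, 1 ≤ i → 1 ≤ g i)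
    (h : ∀ i, 1 ≤ i → i < N → g (i + 1) * b i ≤ (g (i + 1) - 1) * b (i + 1)) :
    (∏ i ∈ Finset.Icc 2 N, g i) * b 1 ≤ (∏ i ∈ Finset.Icc 2 N, (g i - 1)) * b N := by
  induction N, hN using Nat.le_induction with
  | base => simp
  | succ n hn ih =>
    have ih := ih fun i h1 h2 => h i h1 (by omega)
    have hP : 0 ≤ ∏ i ∈ Finset.Icc 2 n, (g i - 1) := Finset.prod_nonneg fun i hi => by
      linarith [hg i (by have := (Finset.mem_Icc.1 hi).1; omega)]
    rw [Finset.prod_Icc_succ_top (by omega), Finset.prod_Icc_succ_top (by omega)]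
    have h1 := mul_le_mul_of_nonneg_left ih (by linarith [hg (n + 1) (by omega)] : 0 ≤ g (n + 1))
    have h2 := mul_le_mul_of_nonneg_left (h n hn (by omega)) hP
    linarith

/-- Relaxed dynamic-programming inequality (3.9)/(4.11) for the MPC feedback:
for an exponentially controllable system with positive running cost, the horizon-`N`
value function satisfies `V_N(x) ≥ V_N(F(x, μ(x))) + α_N ℓ(x, μ(x))` with the explicit
suboptimality degree `α_N` computed from the overshoot `C` and decay rate `σ`. -/
theorem mpc_relaxed_dynamic_programming
    {S U : Type*} [Nonempty U] (F : S → U → S) (ℓ : S → U → ℝ)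
    (hℓpos : ∀ x u, 0 < ℓ x u)
    (C σ : ℝ) (hC : 1 ≤ C) (hσ0 : 0 < σ) (hσ1 : σ < 1)
    (hexp : ∀ x : S, ∃ u : ℕ → U,
      ∀ n : ℕ, ℓ (traj F x u n) (u n) ≤ C * σ ^ n * ellStar ℓ x)
    (N : ℕ) (hN : 2 ≤ N)
    (ustar : S → ℕ → U)
    (hopt : ∀ x : S, costJ F ℓ N x (ustar x) = valueV F ℓ N x)
    (μ : S → U) (hμ : ∀ x : S, μ x = ustar x 0)
    (γ : ℕ → ℝ) (hγ : ∀ i, γ i = C * ∑ n ∈ Finset.range i, σ ^ n)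
    (αN : ℝ)
    (hαN : αN = 1 - ((γ N - 1) * ∏ i ∈ Finset.Icc 2 N, (γ i - 1)) /
      ((∏ i ∈ Finset.Icc 2 N, γ i) - ∏ i ∈ Finset.Icc 2 N, (γ i - 1)))
    (hαpos : 0 < αN) :
    ∀ x : S, valueV F ℓ N x ≥ valueV F ℓ N (F x (μ x)) + αN * ℓ x (μ x) := by
  intro x
  have hℓ : ∀ x u, 0 ≤ ℓ x u := fun x u => (hℓpos x u).le
  have hg : ∀ i, 1 ≤ i → 1 ≤ γ i := by
    intro i hi
    have h1 : (1 : ℝ) ≤ ∑ n ∈ Finset.range i, σ ^ n := by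
      simpa using Finset.single_le_sum (f := fun n => σ ^ n)
        (fun n _ => pow_nonneg hσ0.le n) (Finset.mem_range.2 hi)
    rw [hγ]
    nlinarith
  have hctrl : ∀ (M : ℕ) (y : S) (a : U), ∃ v, costJ F ℓ M y v ≤ γ M * ℓ y a := by
    intro M y a
    obtain ⟨v, hv⟩ := hexp y
    exact ⟨v, hγ M ▸ costJ_le_of_exp_decay F hℓ (by linarith) hσ0.le hv M a⟩
  rw [hμ x, ← hopt x]
  have hV : costJ F ℓ N x (ustar x) ≤ γ N * ℓ x (ustar x 0) := by
    obtain ⟨v, hv⟩ := hctrl N x (ustar x 0)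
    exact (hopt x).trans_le ((valueV_le_costJ F hℓ N x v).trans hv)
  generalize ustar x = u at hV ⊢
  set ν := valueV F ℓ N (F x (u 0))
  have hchain := prod_Icc_mul_le (g := γ)
    (b := fun i => ν + ℓ x (u 0) - costJ F ℓ (N + 1 - i) x u) (by omega : 1 ≤ N) hg (by
      intro i hi hiN
      obtain ⟨m, rfl⟩ : ∃ m, N = m + 1 + i := ⟨N - 1 - i, by omega⟩
      obtain ⟨v, hv⟩ := hctrl (i + 1) (traj F x u (m + 1)) (u (m + 1))
      have hν := valueV_add_le F hℓ m (i + 1) (F x (u 0)) (fun k => u (k + 1)) v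
      rw [traj_shift, show m + (i + 1) = m + 1 + i by omega] at hν
      change ν ≤ _ at hν
      have e1 : m + 1 + i + 1 - i = m + 1 + 1 := by omega
      have e2 : m + 1 + i + 1 - (i + 1) = m + 1 := by omega
      have hs : costJ F ℓ (m + 1 + 1) x u =
        costJ F ℓ (m + 1) x u + ℓ (traj F x u (m + 1)) (u (m + 1)) := Finset.sum_range_succ _ _
      simp only [e1, e2, hs]
      have := costJ_succ F ℓ x u m
      linarith)
  have hone : costJ F ℓ 1 x u = ℓ x (u 0) := by simp [costJ, traj]
  simp only [Nat.add_sub_cancel, Nat.add_sub_cancel_left, hone] at hchain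
  have hP : 0 ≤ ∏ i ∈ Finset.Icc 2 N, (γ i - 1) := Finset.prod_nonneg fun i hi => by
    linarith [hg i (by have := (Finset.mem_Icc.1 hi).1; omega)]
  have hPQ : ∏ i ∈ Finset.Icc 2 N, (γ i - 1) < ∏ i ∈ Finset.Icc 2 N, γ i := by
    obtain ⟨n, rfl⟩ : ∃ n, N = n + 1 := ⟨N - 1, by omega⟩
    have hle : ∏ i ∈ Finset.Icc 2 n, (γ i - 1) ≤ ∏ i ∈ Finset.Icc 2 n, γ i :=
      Finset.prod_le_prod
        (fun i hi => by linarith [hg i (by have := (Finset.mem_Icc.1 hi).1; omega)])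
        (fun i _ => by linarith)
    have hpos : 0 < ∏ i ∈ Finset.Icc 2 n, γ i := Finset.prod_pos fun i hi => by
      linarith [hg i (by have := (Finset.mem_Icc.1 hi).1; omega)]
    rw [Finset.prod_Icc_succ_top (by omega), Finset.prod_Icc_succ_top (by omega)]
    nlinarith [hg (n + 1) (by omega)]
  set P := ∏ i ∈ Finset.Icc 2 N, (γ i - 1)
  set Q := ∏ i ∈ Finset.Icc 2 N, γ i
  have hkey : ν + ℓ x (u 0) - costJ F ℓ N x u ≤ ((γ N - 1) * P / (Q - P)) * ℓ x (u 0) := by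
    rw [div_mul_eq_mul_div, le_div_iff₀ (by linarith)]
    nlinarith [mul_le_mul_of_nonneg_left hV hP]
  rw [hαN]
  linarith
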